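/- arXiv:q-bio/0505023 — 5 statements merged into one kernel-verified Lean document; each statement's English description precedes it below -/
import Mathlib

section
/- Let G=(V,E) be a finite simple graph with V={1,...,v}, v ≥ 2 and e = |E| ≥ 1, and let t = MAX-CUT(G). Then the minimum number of flips needed to make the SNP matrix M(G) feasible equals e(v−2) + 2(e−t). -/
/-- A haplotype of length `m`: a string over `{0,1}`. -/
abbrev Haplo (m : ℕ) := Fin m → Bool

/-- A row of an SNP matrix: entries in `{0,1,-}`, where `none` is a hole. -/
abbrev SnpRow (m : ℕ) := Fin m → Option Bool

/-- `dist r H` is the number of positions where `r` has a non-hole entry differing from `H`. -/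
def dist {m : ℕ} (r : SnpRow m) (H : Haplo m) : ℕ :=
  (Finset.univ.filter fun p => r p ≠ none ∧ r p ≠ some (H p)).card

/-- An SNP matrix is feasible if two haplotypes fit all its rows. -/
def Feasible {ρ : Type} {m : ℕ} (M : ρ → SnpRow m) : Prop :=
  ∃ H1 H2 : Haplo m, ∀ i, dist (M i) H1 = 0 ∨ dist (M i) H2 = 0

/-- Two matrices have the same hole pattern (flips never create or destroy holes). -/
def SamePattern {ρ : Type} {m : ℕ} (M M' : ρ → SnpRow m) : Prop :=
  ∀ i p, M i p = none ↔ M' i p = none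

/-- Number of entries where the two matrices differ. -/
def flipCount {ρ : Type} [Fintype ρ] {m : ℕ} (M M' : ρ → SnpRow m) : ℕ :=
  (Finset.univ.filter fun q : ρ × Fin m => M q.1 q.2 ≠ M' q.1 q.2).card

/-- Minimum number of flips needed to make `M` feasible. -/
noncomputable def minFlips {ρ : Type} [Fintype ρ] {m : ℕ} (M : ρ → SnpRow m) : ℕ :=
  sInf {c | ∃ M' : ρ → SnpRow m, SamePattern M M' ∧ Feasible M' ∧ flipCount M M' = c}

/-- The edges of `G`, as ordered pairs `(i,j)` with `i < j`. -/
def edgePairs (v : ℕ) (G : SimpleGraph (Fin v)) [DecidableRel G.Adj] :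
    Finset (Fin v × Fin v) :=
  Finset.univ.filter fun p => p.1 < p.2 ∧ G.Adj p.1 p.2

/-- `e = |E|`. -/
def numEdges (v : ℕ) (G : SimpleGraph (Fin v)) [DecidableRel G.Adj] : ℕ :=
  (edgePairs v G).card

/-- A row of block `M_0` for vertex `j` (0-indexed): 0s in the two columns of `j`, holes elsewhere. -/
def M0row (v : ℕ) (j : ℕ) : SnpRow (2 * v) :=
  fun c => if c.val / 2 = j then some false else none

/-- A row of block `M_1` for vertex `j` (0-indexed): 1s in the two columns of `j`, holes elsewhere. -/
def M1row (v : ℕ) (j : ℕ) : SnpRow (2 * v) :=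
  fun c => if c.val / 2 = j then some true else none

/-- The row of block `M_G` for the edge `{i,j}` with `i < j` (0-indexed vertices):
0s in the columns of `i`, 1s in the columns of `j`, and `01` in the column pairs
of all other vertices. -/
def MGrow (v : ℕ) (i j : Fin v) : SnpRow (2 * v) :=
  fun c =>
    if c.val / 2 = i.val then some false
    else if c.val / 2 = j.val then some true
    else some (decide (c.val % 2 = 1))

/-- Index type for the rows of block `M_G`: one row per edge. -/
abbrev EdgeIdx (v : ℕ) (G : SimpleGraph (Fin v)) [DecidableRel G.Adj] :=
  {p : Fin v × Fin v // p ∈ edgePairs v G}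

/-- Index type for the rows of `M(G)`: `k = 2ev²` rows in each of `M_0` and `M_1`,
and one row per edge in `M_G`. -/
abbrev RowIdx (v : ℕ) (G : SimpleGraph (Fin v)) [DecidableRel G.Adj] :=
  Fin (2 * numEdges v G * v ^ 2) ⊕ (Fin (2 * numEdges v G * v ^ 2) ⊕ EdgeIdx v G)

/-- The SNP matrix `M(G)`: each vertex `j` gets `k/v = 2ev` rows in `M_0` and in `M_1`
(row `t` of `M_0` belongs to vertex `t / (2ev)`), plus one `M_G` row per edge. -/
def MofG (v : ℕ) (G : SimpleGraph (Fin v)) [DecidableRel G.Adj] :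
    RowIdx v G → SnpRow (2 * v)
  | .inl t => M0row v (t.val / (2 * numEdges v G * v))
  | .inr (.inl t) => M1row v (t.val / (2 * numEdges v G * v))
  | .inr (.inr p) => MGrow v p.val.1 p.val.2

/-- `cut(S)`: the number of edges of `G` with exactly one endpoint in `S`. -/
def cutS (v : ℕ) (G : SimpleGraph (Fin v)) [DecidableRel G.Adj] (S : Finset (Fin v)) : ℕ :=
  ((edgePairs v G).filter fun p => (p.1 ∈ S ∧ p.2 ∉ S) ∨ (p.1 ∉ S ∧ p.2 ∈ S)).card

/-- `MAX-CUT(G)`. -/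
def maxCut (v : ℕ) (G : SimpleGraph (Fin v)) [DecidableRel G.Adj] : ℕ :=
  Finset.univ.sup fun S : Finset (Fin v) => cutS v G S

def rd {m : ℕ} (r r' : SnpRow m) : ℕ := (Finset.univ.filter fun p => r p ≠ r' p).card

theorem flipCount_eq {ρ : Type} [Fintype ρ] {m : ℕ} (M M' : ρ → SnpRow m) :
    flipCount M M' = ∑ i, rd (M i) (M' i) := by
  unfold flipCount rd
  simp only [Finset.card_filter]
  rw [Fintype.sum_prod_type]

theorem snpdist_zero {m : ℕ} (r : SnpRow m) (H : Haplo m) (h : dist r H = 0) (p : Fin m) :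
    r p = none ∨ r p = some (H p) := by
  unfold _root_.dist at h
  rw [Finset.card_eq_zero, Finset.filter_eq_empty_iff] at h
  have := h (Finset.mem_univ p)
  tauto

theorem rd_eq {m : ℕ} (r r' : SnpRow m) (H : Haplo m) (hp : ∀ p, r p = none ↔ r' p = none)
    (h : dist r' H = 0) : rd r r' = dist r H := by
  unfold rd
  unfold _root_.dist
  congr 1
  apply Finset.filter_congr
  intro p _
  have h1 := snpdist_zero r' H h p
  have h2 := hp p
  rcases h1 with h1 | h1
  · rw [h1] at h2 ⊢
    simp [h2]
  · rw [h1] at h2 ⊢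
    simp at h2
    simp [h2]

theorem sum_pairs (f : ℕ → ℕ) (v : ℕ) :
    ∑ c : Fin (2 * v), f c.val = ∑ u : Fin v, (f (2 * u.val) + f (2 * u.val + 1)) := by
  rw [Fin.sum_univ_eq_sum_range, Fin.sum_univ_eq_sum_range (fun u => f (2 * u) + f (2 * u + 1))]
  induction v with
  | zero => simp
  | succ n ih =>
    rw [Finset.sum_range_succ, ← ih, show 2 * (n + 1) = 2 * n + 1 + 1 by ring,
      Finset.sum_range_succ, Finset.sum_range_succ, add_assoc]

theorem distMG (v : ℕ) (i j : Fin v) (hij : i ≠ j) (b : ℕ → Bool) :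
    dist (MGrow v i j) (fun c => b (c.val / 2)) + 2 =
      v + (if b i.val = true then 2 else 0) + (if b j.val = false then 2 else 0) := by
  have hij' : i.val ≠ j.val := fun h => hij (Fin.ext h)
  unfold _root_.dist
  rw [Finset.card_filter]
  have h0 := sum_pairs (fun c => if (if c / 2 = i.val then some false
    else if c / 2 = j.val then some true
    else some (decide (c % 2 = 1))) ≠ some (b (c / 2)) then 1 else 0) v
  have h1 : ∀ u : Fin v, ((if (if (2 * u.val) / 2 = i.val then some false
    else if (2 * u.val) / 2 = j.val then some true
    else some (decide ((2 * u.val) % 2 = 1))) ≠ some (b ((2 * u.val) / 2)) then 1 else 0) +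
    (if (if (2 * u.val + 1) / 2 = i.val then some false
    else if (2 * u.val + 1) / 2 = j.val then some true
    else some (decide ((2 * u.val + 1) % 2 = 1))) ≠ some (b ((2 * u.val + 1) / 2)) then 1 else 0))
     + ((if u = i then 1 else 0) + (if u = j then 1 else 0)) =
     1 + ((if u = i then (if b i.val = true then 2 else 0) else 0)
       + (if u = j then (if b j.val = false then 2 else 0) else 0)) := by
    intro u
    have e1 : 2 * u.val / 2 = u.val := by omega
    have e2 : (2 * u.val + 1) / 2 = u.val := by omega
    have e3 : 2 * u.val % 2 = 0 := by omega
    have e4 : (2 * u.val + 1) % 2 = 1 := by omega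
    rw [e1, e2, e3, e4]
    by_cases hi : u = i
    · subst hi
      simp [hij]
      cases b u.val <;> simp
    · have hi' : u.val ≠ i.val := fun h => hi (Fin.ext h)
      by_cases hj : u = j
      · subst hj
        simp [hi, hi']
        cases b u.val <;> simp
      · have hj' : u.val ≠ j.val := fun h => hj (Fin.ext h)
        simp [hi, hi', hj, hj']
        cases b u.val <;> simp
  have h2 := Finset.sum_congr (rfl : (Finset.univ : Finset (Fin v)) = _) (fun u _ => h1 u)
  rw [Finset.sum_add_distrib, ← h0] at h2
  simp [Finset.sum_add_distrib] at h2
  have h3 : (∑ c : Fin (2 * v), if MGrow v i j c ≠ none ∧ MGrow v i j c ≠ some (b (c.val / 2))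
      then 1 else 0) = ∑ x : Fin (2 * v), if (if x.val / 2 = i.val then some false
      else if x.val / 2 = j.val then some true else some (decide (x.val % 2 = 1))) =
        some (b (x.val / 2)) then 0 else 1 := by
    apply Finset.sum_congr rfl
    intro c _
    unfold MGrow
    have hne : (if c.val / 2 = i.val then some false
      else if c.val / 2 = j.val then some true else some (decide (c.val % 2 = 1))) ≠ none := by
      split_ifs <;> simp
    simp only [ne_eq, hne, not_false_eq_true, true_and, ite_not]
  rw [h3]
  omega

def ecost (v : ℕ) (b : ℕ → Bool) (p : Fin v × Fin v) : ℕ :=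
  (v - 2) + if b p.1.val = b p.2.val then 2 else 0

theorem ecost_sum (v : ℕ) (G : SimpleGraph (Fin v)) [DecidableRel G.Adj] (b : ℕ → Bool)
    (S : Finset (Fin v)) (hS : ∀ u, u ∈ S ↔ b u.val = true) :
    (∑ p : EdgeIdx v G, ecost v b p.val) =
      numEdges v G * (v - 2) + 2 * (numEdges v G - cutS v G S) := by
  rw [Finset.sum_coe_sort (edgePairs v G) (fun p => ecost v b p)]
  unfold ecost
  rw [Finset.sum_add_distrib, Finset.sum_const, smul_eq_mul]
  have h := Finset.card_filter_add_card_filter_not (s := edgePairs v G)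
    (fun p => (p.1 ∈ S ∧ p.2 ∉ S) ∨ (p.1 ∉ S ∧ p.2 ∈ S))
  have h2 : ∑ p ∈ edgePairs v G, (if b p.1.val = b p.2.val then 2 else 0) =
     2 * ((edgePairs v G).filter
      fun p => ¬ ((p.1 ∈ S ∧ p.2 ∉ S) ∨ (p.1 ∉ S ∧ p.2 ∈ S))).card := by
    rw [Finset.card_filter, Finset.mul_sum]
    apply Finset.sum_congr rfl
    intro p _
    simp only [hS]
    cases b p.1.val <;> cases b p.2.val <;> simp
  rw [h2]
  unfold numEdges cutS
  omega

theorem edge_ne (v : ℕ) (G : SimpleGraph (Fin v)) [DecidableRel G.Adj] (p : EdgeIdx v G) :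
    p.val.1 ≠ p.val.2 := by
  have := p.2
  simp only [edgePairs, Finset.mem_filter] at this
  exact ne_of_lt this.2.1

theorem snpdist_eq_zero {m : ℕ} (r : SnpRow m) (H : Haplo m)
    (h : ∀ p, r p = none ∨ r p = some (H p)) : dist r H = 0 := by
  unfold _root_.dist
  rw [Finset.card_eq_zero, Finset.filter_eq_empty_iff]
  intro p _
  have := h p
  tauto

theorem upper (v : ℕ) (hv : 2 ≤ v) (G : SimpleGraph (Fin v)) [DecidableRel G.Adj]
    (b : ℕ → Bool) :
    ∃ M' : RowIdx v G → SnpRow (2 * v), SamePattern (MofG v G) M' ∧ Feasible M' ∧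
      flipCount (MofG v G) M' = ∑ p : EdgeIdx v G, ecost v b p.val := by
  let s : RowIdx v G → Bool
    | .inl t => b (t.val / (2 * numEdges v G * v))
    | .inr (.inl t) => ! b (t.val / (2 * numEdges v G * v))
    | .inr (.inr p) => b p.val.1.val
  let H : RowIdx v G → Haplo (2 * v) := fun i c => xor (s i) (b (c.val / 2))
  let M' : RowIdx v G → SnpRow (2 * v) := fun i c => (MofG v G i c).map (fun _ => H i c)
  have hsp : SamePattern (MofG v G) M' := by
    intro i p
    simp [M']
  have hd : ∀ i, dist (M' i) (H i) = 0 := by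
    intro i
    apply snpdist_eq_zero
    intro p
    simp only [M']
    cases MofG v G i p <;> simp
  refine ⟨M', hsp, ⟨fun c => b (c.val / 2), fun c => ! b (c.val / 2), ?_⟩, ?_⟩
  · intro i
    have := hd i
    simp only [H] at this
    cases hs : s i
    · left; simpa [hs] using this
    · right; simpa [hs] using this
  · rw [flipCount_eq]
    have : ∀ i, rd (MofG v G i) (M' i) = dist (MofG v G i) (H i) :=
      fun i => rd_eq _ _ _ (hsp i) (hd i)
    simp only [this, Fintype.sum_sum_type]
    have h1 : ∀ t, dist (MofG v G (.inl t)) (H (.inl t)) = 0 := by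
      intro t
      apply snpdist_eq_zero
      intro p
      simp only [MofG, M0row, H, s]
      split_ifs with h
      · right; simp [h]
      · left; rfl
    have h2 : ∀ t, dist (MofG v G (.inr (.inl t))) (H (.inr (.inl t))) = 0 := by
      intro t
      apply snpdist_eq_zero
      intro p
      simp only [MofG, M1row, H, s]
      split_ifs with h
      · right; simp [h]
      · left; rfl
    simp only [h1, h2, Finset.sum_const_zero, zero_add]
    apply Finset.sum_congr rfl
    intro p _
    have := distMG v p.val.1 p.val.2 (edge_ne v G p) (fun n => xor (b p.val.1.val) (b n))
    simp only [MofG, H, s, ecost]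
    cases h3 : b p.val.1.val <;> cases h4 : b p.val.2.val <;> simp [h3, h4] at this ⊢ <;> omega

theorem many {ρ : Type} [Fintype ρ] {m n : ℕ} (M M' : ρ → SnpRow m) (f : Fin n → ρ)
    (hf : Function.Injective f) (h : ∀ t, 1 ≤ rd (M (f t)) (M' (f t))) :
    n ≤ flipCount M M' := by
  classical
  rw [flipCount_eq]
  calc n = ∑ t : Fin n, 1 := by simp
    _ ≤ ∑ t : Fin n, rd (M (f t)) (M' (f t)) := Finset.sum_le_sum (fun t _ => h t)
    _ = ∑ i ∈ Finset.univ.image f, rd (M i) (M' i) := by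
        rw [Finset.sum_image (fun x _ y _ h => hf h)]
    _ ≤ _ := Finset.sum_le_sum_of_subset (Finset.subset_univ _)

theorem rd_zero {m : ℕ} (r r' : SnpRow m) (h : ¬ 1 ≤ rd r r') : r = r' := by
  have : rd r r' = 0 := by omega
  unfold rd at this
  rw [Finset.card_eq_zero, Finset.filter_eq_empty_iff] at this
  funext p
  have := this (Finset.mem_univ p)
  tauto

theorem rowIdx_lt (v e u t : ℕ) (hu : u < v) (ht : t < 2 * e * v) :
    2 * e * v * u + t < 2 * e * v ^ 2 := by
  have : 2 * e * v * (u + 1) ≤ 2 * e * v * v := Nat.mul_le_mul_left _ hu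
  nlinarith

theorem lower (v : ℕ) (hv : 2 ≤ v) (G : SimpleGraph (Fin v)) [DecidableRel G.Adj]
    (M' : RowIdx v G → SnpRow (2 * v)) (hsp : SamePattern (MofG v G) M') (hf : Feasible M')
    (hlt : flipCount (MofG v G) M' < 2 * numEdges v G * v) :
    ∃ b : ℕ → Bool, ∑ p : EdgeIdx v G, ecost v b p.val ≤ flipCount (MofG v G) M' := by
  obtain ⟨H1, H2, hH⟩ := hf
  have key0 : ∀ u : Fin v, (∀ c : Fin (2 * v), c.val / 2 = u.val → H1 c = false) ∨
      (∀ c : Fin (2 * v), c.val / 2 = u.val → H2 c = false) := by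
    intro u
    let f : Fin (2 * numEdges v G * v) → RowIdx v G := fun t =>
      .inl ⟨2 * numEdges v G * v * u.val + t.val, rowIdx_lt v _ _ _ u.2 t.2⟩
    by_contra hc
    refine absurd (many (MofG v G) M' f ?_ ?_) (by omega)
    · intro x y h
      simp [f] at h
      exact Fin.ext h
    · intro t
      by_contra h
      have h := rd_zero _ _ h
      have hu : (2 * numEdges v G * v * u.val + t.val) / (2 * numEdges v G * v) = u.val := by
        rw [Nat.mul_add_div (by have := t.2; omega), Nat.div_eq_of_lt t.2, add_zero]
      apply hc
      rcases hH (f t) with hh | hh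
      · left
        intro c hcu
        have := snpdist_zero _ _ hh c
        rw [← h] at this
        simp only [f, MofG, M0row, hu, hcu] at this
        simpa using this.symm
      · right
        intro c hcu
        have := snpdist_zero _ _ hh c
        rw [← h] at this
        simp only [f, MofG, M0row, hu, hcu] at this
        simpa using this.symm
  have key1 : ∀ u : Fin v, (∀ c : Fin (2 * v), c.val / 2 = u.val → H1 c = true) ∨
      (∀ c : Fin (2 * v), c.val / 2 = u.val → H2 c = true) := by
    intro u
    let f : Fin (2 * numEdges v G * v) → RowIdx v G := fun t =>
      .inr (.inl ⟨2 * numEdges v G * v * u.val + t.val, rowIdx_lt v _ _ _ u.2 t.2⟩)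
    by_contra hc
    refine absurd (many (MofG v G) M' f ?_ ?_) (by omega)
    · intro x y h
      simp [f] at h
      exact Fin.ext h
    · intro t
      by_contra h
      have h := rd_zero _ _ h
      have hu : (2 * numEdges v G * v * u.val + t.val) / (2 * numEdges v G * v) = u.val := by
        rw [Nat.mul_add_div (by have := t.2; omega), Nat.div_eq_of_lt t.2, add_zero]
      apply hc
      rcases hH (f t) with hh | hh
      · left
        intro c hcu
        have := snpdist_zero _ _ hh c
        rw [← h] at this
        simp only [f, MofG, M1row, hu, hcu] at this
        simpa using this.symm
      · right
        intro c hcu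
        have := snpdist_zero _ _ hh c
        rw [← h] at this
        simp only [f, MofG, M1row, hu, hcu] at this
        simpa using this.symm
  let b : ℕ → Bool := fun n => if h : 2 * n < 2 * v then H1 ⟨2 * n, h⟩ else false
  have hb : ∀ c : Fin (2 * v), H1 c = b (c.val / 2) ∧ H2 c = ! b (c.val / 2) := by
    intro c
    have hc := c.2
    have hu : c.val / 2 < v := by omega
    have hlt : 2 * (c.val / 2) < 2 * v := by omega
    have hq : (2 * (c.val / 2)) / 2 = c.val / 2 := by omega
    simp only [b, hlt, dite_true]
    rcases key0 ⟨_, hu⟩ with h0 | h0 <;> rcases key1 ⟨_, hu⟩ with h1 | h1 <;>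
      have a0 := h0 c rfl <;> have a1 := h1 c rfl <;>
      have d0 := h0 ⟨_, hlt⟩ hq <;> have d1 := h1 ⟨_, hlt⟩ hq <;> simp_all
  have e1 : H1 = fun c => b (c.val / 2) := funext fun c => (hb c).1
  have e2 : H2 = fun c => ! b (c.val / 2) := funext fun c => (hb c).2
  refine ⟨b, ?_⟩
  rw [flipCount_eq, Fintype.sum_sum_type, Fintype.sum_sum_type]
  refine le_trans (Finset.sum_le_sum ?_) (le_trans (Nat.le_add_left _ _) (Nat.le_add_left _ _))
  intro p _
  have n1 := distMG v p.val.1 p.val.2 (edge_ne v G p) b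
  have n2 := distMG v p.val.1 p.val.2 (edge_ne v G p) (fun n => ! b n)
  rcases hH (.inr (.inr p)) with hh | hh
  · rw [rd_eq _ _ _ (hsp _) hh, e1]
    simp only [MofG, ecost]
    cases h3 : b p.val.1.val <;> cases h4 : b p.val.2.val <;> simp [h3, h4] at n1 ⊢ <;> omega
  · rw [rd_eq _ _ _ (hsp _) hh, e2]
    simp only [MofG, ecost]
    cases h3 : b p.val.1.val <;> cases h4 : b p.val.2.val <;> simp [h3, h4] at n2 ⊢ <;> omega

theorem stmt0 (v : ℕ) (hv : 2 ≤ v) (G : SimpleGraph (Fin v)) [DecidableRel G.Adj]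
    (he : 1 ≤ numEdges v G) :
    minFlips (MofG v G) =
      numEdges v G * (v - 2) + 2 * (numEdges v G - maxCut v G) := by
  obtain ⟨S, _, hS⟩ := Finset.exists_mem_eq_sup (Finset.univ : Finset (Finset (Fin v)))
    Finset.univ_nonempty (fun S => cutS v G S)
  change maxCut v G = cutS v G S at hS
  let b : ℕ → Bool := fun n => if h : n < v then decide (⟨n, h⟩ ∈ S) else false
  obtain ⟨M0, h1, h2, h3⟩ := upper v hv G b
  rw [ecost_sum v G b S (by intro u; simp [b]), ← hS] at h3
  unfold minFlips
  apply le_antisymm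
  · exact Nat.sInf_le ⟨M0, h1, h2, h3⟩
  · refine le_csInf ⟨_, M0, h1, h2, h3⟩ ?_
    rintro c ⟨M', g1, g2, rfl⟩
    by_cases hlt : flipCount (MofG v G) M' < 2 * numEdges v G * v
    · obtain ⟨b', hb'⟩ := lower v hv G M' g1 g2 hlt
      rw [ecost_sum v G b' (Finset.univ.filter fun u => b' u.val = true) (by simp)] at hb'
      have : cutS v G (Finset.univ.filter fun u : Fin v => b' u.val = true) ≤ maxCut v G :=
        Finset.le_sup (f := fun S => cutS v G S) (Finset.mem_univ _)
      omega
    · obtain ⟨w, rfl⟩ := Nat.exists_eq_add_of_le hv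
      rw [show 2 + w - 2 = w by omega]
      have : 2 * (numEdges (2 + w) G - maxCut (2 + w) G) ≤ 2 * numEdges (2 + w) G := by omega
      nlinarith
end

section
/- Let G=(V,E) be a finite simple graph with V={1,...,v}, v ≥ 2 and e = |E| ≥ 1. If (H1,H2) is a pair of haplotypes in {0,1}^{2v} that is NOT partition-encoding, then the sum, over all rows r of the blocks M_0 and M_1 of M(G), of min(d(r,H1), d(r,H2)) is at least 2ev (which is strictly greater than ve, so minimal feasibility-inducing flip sets always correspond to partition-encoding haplotype pairs). -/
/-- A haplotype on `2v` columns has the double-entry property if its entries on the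
two columns of each vertex agree. -/
def DoubleEntry {v : ℕ} (H : Haplo (2 * v)) : Prop :=
  ∀ c c' : Fin (2 * v), c.val / 2 = c'.val / 2 → H c = H c'

/-- A pair of haplotypes is partition-encoding if both have the double-entry property
and the second is the bitwise complement of the first. -/
def PartitionEncoding {v : ℕ} (H1 H2 : Haplo (2 * v)) : Prop :=
  DoubleEntry H1 ∧ DoubleEntry H2 ∧ ∀ c, H2 c = !H1 c

lemma dist_zero_M0 {v j : ℕ} {H : Haplo (2 * v)} (h : _root_.dist (M0row v j) H = 0)
    (c : Fin (2 * v)) (hc : c.val / 2 = j) : H c = false := by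
  unfold _root_.dist at h
  rw [Finset.card_eq_zero, Finset.filter_eq_empty_iff] at h
  have := h (Finset.mem_univ c)
  simp [M0row, hc] at this
  exact this

lemma dist_zero_M1 {v j : ℕ} {H : Haplo (2 * v)} (h : _root_.dist (M1row v j) H = 0)
    (c : Fin (2 * v)) (hc : c.val / 2 = j) : H c = true := by
  unfold _root_.dist at h
  rw [Finset.card_eq_zero, Finset.filter_eq_empty_iff] at h
  have := h (Finset.mem_univ c)
  simp [M1row, hc] at this
  exact this

lemma sum_block (N K v : ℕ) (hK : K = N * v) (f : ℕ → ℕ) (j : ℕ) (hj : j < v)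
    (hf : 1 ≤ f j) : N ≤ ∑ t : Fin K, f (t.val / N) := by
  have hlt : ∀ s : Fin N, j * N + s.val < K := by
    intro s
    have h1 : (j + 1) * N ≤ v * N := Nat.mul_le_mul_right N hj
    have h2 := s.isLt
    rw [hK]
    nlinarith
  let g : Fin N ↪ Fin K := ⟨fun s => ⟨j * N + s.val, hlt s⟩, by
    intro a b hab
    simp only [Fin.mk.injEq] at hab
    ext
    omega⟩
  calc N = ∑ _s : Fin N, 1 := by simp
    _ ≤ ∑ s : Fin N, f ((g s).val / N) := by
        apply Finset.sum_le_sum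
        intro s _
        have : (g s).val / N = j := by
          change (j * N + s.val) / N = j
          have hN : 0 < N := s.pos
          rw [mul_comm, Nat.mul_add_div hN, Nat.div_eq_of_lt s.isLt, add_zero]
        rw [this]; exact hf
    _ = ∑ t ∈ Finset.univ.map g, f (t.val / N) := by rw [Finset.sum_map]
    _ ≤ _ := Finset.sum_le_sum_of_subset (Finset.subset_univ _)

lemma pe_of_zero {v : ℕ} {H1 H2 : Haplo (2 * v)}
    (h : ∀ j < v, min (_root_.dist (M0row v j) H1) (_root_.dist (M0row v j) H2) = 0 ∧
      min (_root_.dist (M1row v j) H1) (_root_.dist (M1row v j) H2) = 0) :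
    PartitionEncoding H1 H2 := by
  have key : ∀ c : Fin (2 * v), ∃ b : Bool, ∀ c' : Fin (2 * v), c'.val / 2 = c.val / 2 →
      H1 c' = b ∧ H2 c' = !b := by
    intro c
    have hj : c.val / 2 < v := by have := c.isLt; omega
    obtain ⟨h0, h1⟩ := h _ hj
    rw [Nat.min_eq_zero_iff] at h0 h1
    rcases h0 with h0 | h0 <;> rcases h1 with h1 | h1
    · have := dist_zero_M0 h0 c rfl
      have := dist_zero_M1 h1 c rfl
      simp_all
    · exact ⟨false, fun c' hc => ⟨dist_zero_M0 h0 c' hc, dist_zero_M1 h1 c' hc⟩⟩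
    · exact ⟨true, fun c' hc => ⟨dist_zero_M1 h1 c' hc, dist_zero_M0 h0 c' hc⟩⟩
    · have := dist_zero_M0 h0 c rfl
      have := dist_zero_M1 h1 c rfl
      simp_all
  refine ⟨fun c c' hc => ?_, fun c c' hc => ?_, fun c => ?_⟩
  · obtain ⟨b, hb⟩ := key c
    rw [(hb c rfl).1, (hb c' hc.symm).1]
  · obtain ⟨b, hb⟩ := key c
    rw [(hb c rfl).2, (hb c' hc.symm).2]
  · obtain ⟨b, hb⟩ := key c
    rw [(hb c rfl).2, (hb c rfl).1]

theorem stmt2 (v : ℕ) (hv : 2 ≤ v) (G : SimpleGraph (Fin v)) [DecidableRel G.Adj]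
    (he : 1 ≤ numEdges v G) (H1 H2 : Haplo (2 * v))
    (hnpe : ¬ PartitionEncoding H1 H2) :
    2 * numEdges v G * v ≤
      ((∑ t : Fin (2 * numEdges v G * v ^ 2),
          min (dist (MofG v G (Sum.inl t)) H1) (dist (MofG v G (Sum.inl t)) H2)) +
       (∑ t : Fin (2 * numEdges v G * v ^ 2),
          min (dist (MofG v G (Sum.inr (Sum.inl t))) H1)
              (dist (MofG v G (Sum.inr (Sum.inl t))) H2))) ∧
    v * numEdges v G < 2 * numEdges v G * v := by
  constructor
  · have hK : 2 * numEdges v G * v ^ 2 = 2 * numEdges v G * v * v := by ring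
    by_contra hcon
    apply hnpe
    apply pe_of_zero
    intro j hj
    constructor
    · by_contra h
      have := sum_block _ _ v hK
        (fun j => min (_root_.dist (M0row v j) H1) (_root_.dist (M0row v j) H2)) j hj
        (Nat.one_le_iff_ne_zero.mpr h)
      exact hcon (this.trans (Nat.le_add_right _ _))
    · by_contra h
      have := sum_block _ _ v hK
        (fun j => min (_root_.dist (M1row v j) H1) (_root_.dist (M1row v j) H2)) j hj
        (Nat.one_le_iff_ne_zero.mpr h)
      exact hcon (this.trans (Nat.le_add_left _ _))
  · have : 0 < numEdges v G * v := Nat.mul_pos he (by omega)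
    nlinarith
end

section
/- Let G=(V,E) be a finite simple graph with V={1,...,v}, v ≥ 2 and e = |E| ≥ 1. Let (H1,H2) be a partition-encoding pair of haplotypes in {0,1}^{2v} and let S = {j ∈ V : H1 has a 1 in columns 2j−1 and 2j}. Then for the row r of the block M_G of M(G) encoding an edge {i,j} ∈ E: min(d(r,H1), d(r,H2)) = v−2 if exactly one of i,j belongs to S, and min(d(r,H1), d(r,H2)) = v otherwise. -/
/-- The vertex set `S` encoded by a haplotype: vertices on whose columns `H1` has 1s. -/
def Sset {v : ℕ} (H1 : Haplo (2 * v)) : Finset (Fin v) :=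
  Finset.univ.filter fun j => H1 ⟨2 * j.val, by have := j.isLt; omega⟩ = true

theorem aux_sum (f : ℕ → ℕ) (v : ℕ) :
    ∑ c ∈ Finset.range (2 * v), f c = ∑ k ∈ Finset.range v, (f (2 * k) + f (2 * k + 1)) := by
  induction v with
  | zero => simp
  | succ n ih =>
    rw [show 2 * (n + 1) = 2 * n + 1 + 1 by ring, Finset.sum_range_succ, Finset.sum_range_succ,
      Finset.sum_range_succ, ih]
    ring

theorem aux_dist (v : ℕ) (i j : Fin v) (hij : i ≠ j) (H : Haplo (2 * v)) (hH : DoubleEntry H)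
    (h : Fin v → Bool)
    (hh : ∀ k : Fin v, h k = H ⟨2 * k.val, by have := k.isLt; omega⟩) :
    dist (MGrow v i j) H + 2 = v + (if h i then 2 else 0) + (if h j then 0 else 2) := by
  have hne : i.val ≠ j.val := fun e => hij (Fin.ext e)
  let g : ℕ → Bool := fun n => if hn : n < v then h ⟨n, hn⟩ else false
  have hg : ∀ c : Fin (2 * v), H c = g (c.val / 2) := by
    intro c
    have hc : c.val / 2 < v := by have := c.isLt; omega
    simp only [g, hc, dif_pos, hh]
    apply hH
    simp
  have hgi : g i.val = h i := by simp [g]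
  have hgj : g j.val = h j := by simp [g]
  let F : ℕ → ℕ := fun c =>
    if (if c / 2 = i.val then false else if c / 2 = j.val then true
      else decide (c % 2 = 1)) ≠ g (c / 2) then 1 else 0
  have h1 : dist (MGrow v i j) H = ∑ c ∈ Finset.range (2 * v), F c := by
    rw [← Fin.sum_univ_eq_sum_range, _root_.dist, Finset.card_filter]
    apply Finset.sum_congr rfl
    intro c _
    simp only [MGrow, F, hg c]
    split_ifs <;> simp_all
  have h2 : ∀ k, (F (2 * k) + F (2 * k + 1)) + (if k = i.val then 1 else 0)
      + (if k = j.val then 1 else 0)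
      = 1 + (if k = i.val then (if h i then 2 else 0) else 0)
        + (if k = j.val then (if h j then 0 else 2) else 0) := by
    intro k
    have e1 : 2 * k / 2 = k := by omega
    have e2 : (2 * k + 1) / 2 = k := by omega
    have e3 : 2 * k % 2 = 0 := by omega
    have e4 : (2 * k + 1) % 2 = 1 := by omega
    simp only [F, e1, e2, e3, e4]
    by_cases hi : k = i.val
    · subst hi
      rw [hgi]
      cases h i <;> simp [hne]
    · by_cases hj : k = j.val
      · subst hj
        rw [hgj]
        cases h j <;> simp [hne.symm]
      · cases g k <;> simp [hi, hj]
  have h3 := Finset.sum_congr (rfl : Finset.range v = Finset.range v) (fun k _ => h2 k)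
  simp only [Finset.sum_add_distrib, Finset.sum_ite_eq', Finset.mem_range, i.isLt, j.isLt,
    if_true, Finset.sum_const, Finset.card_range, smul_eq_mul, mul_one] at h3
  rw [h1, aux_sum, Finset.sum_add_distrib]
  omega

theorem stmt3 (v : ℕ) (hv : 2 ≤ v) (G : SimpleGraph (Fin v)) [DecidableRel G.Adj]
    (he : 1 ≤ numEdges v G) (H1 H2 : Haplo (2 * v))
    (hpe : PartitionEncoding H1 H2) :
    ∀ p : EdgeIdx v G,
      -- if exactly one endpoint of the edge is in S, the row costs v − 2 flips
      ((p.val.1 ∈ Sset H1 ↔ p.val.2 ∉ Sset H1) →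
        min (dist (MGrow v p.val.1 p.val.2) H1) (dist (MGrow v p.val.1 p.val.2) H2)
          = v - 2) ∧
      -- otherwise it costs v flips
      ((p.val.1 ∈ Sset H1 ↔ p.val.2 ∈ Sset H1) →
        min (dist (MGrow v p.val.1 p.val.2) H1) (dist (MGrow v p.val.1 p.val.2) H2)
          = v) := by
  intro p
  obtain ⟨⟨i, j⟩, hp⟩ := p
  obtain ⟨hd1, hd2, hc⟩ := hpe
  have hij : i ≠ j := by
    simp only [edgePairs, Finset.mem_filter] at hp
    exact ne_of_lt hp.2.1
  have a1 := aux_dist v i j hij H1 hd1 _ (fun k => rfl)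
  have a2 := aux_dist v i j hij H2 hd2 _ (fun k => rfl)
  simp only [hc] at a2
  simp only [Sset, Finset.mem_filter, Finset.mem_univ, true_and]
  generalize H1 ⟨2 * i.val, _⟩ = x at *
  generalize H1 ⟨2 * j.val, _⟩ = y at *
  cases x <;> cases y <;> simp at a1 a2 ⊢ <;> omega
end

section
/- Let M be an n×m ungapped SNP matrix whose rows 1,...,n are ordered so that l(i) ≤ l(j) whenever i < j, augmented by two all-hole rows with indices 0 and −1. Then LHR(M) equals the maximum of D[h,k;n] over all pairs of distinct indices h,k ∈ {−1,0,1,...,n} with r(h) ≤ r(k). -/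
/-- Two rows conflict if some column has opposite non-hole entries in them. -/
def Conflict {m : ℕ} (r1 r2 : SnpRow m) : Prop :=
  ∃ (p : Fin m) (b1 b2 : Bool), r1 p = some b1 ∧ r2 p = some b2 ∧ b1 ≠ b2

/-- A row is ungapped if its non-hole entries occupy a contiguous interval of columns. -/
def Ungapped {m : ℕ} (r : SnpRow m) : Prop :=
  ∀ p q s : Fin m, p ≤ q → q ≤ s → r p ≠ none → r s ≠ none → r q ≠ none

/-- `l(r)`: leftmost non-hole column (1-indexed); `0` for an all-hole row. -/
noncomputable def lcol {m : ℕ} (r : SnpRow m) : ℕ :=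
  sInf {c | ∃ p : Fin m, r p ≠ none ∧ p.val + 1 = c}

/-- `r(r)`: rightmost non-hole column (1-indexed); `0` for an all-hole row. -/
def rcol {m : ℕ} (r : SnpRow m) : ℕ :=
  (Finset.univ.filter fun p : Fin m => r p ≠ none).sup fun p => p.val + 1

/-- The length of a haplotype: its number of non-hole columns. -/
def hlen {m : ℕ} (r : SnpRow m) : ℕ :=
  (Finset.univ.filter fun p : Fin m => r p ≠ none).card

/-- The merged haplotype of a set `R` of rows of `M`: at each column, the value some row
of `R` carries there, and a hole if all rows of `R` have a hole there. -/
def mergeRow {m : ℕ} (M : ℤ → SnpRow m) (R : Finset ℤ) : SnpRow m := fun p =>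
  if ∃ i ∈ R, M i p = some true then some true
  else if ∃ i ∈ R, M i p = some false then some false
  else none

/-- A set of rows is pairwise non-conflicting. -/
def PairwiseOK {m : ℕ} (M : ℤ → SnpRow m) (R : Finset ℤ) : Prop :=
  ∀ i ∈ R, ∀ j ∈ R, ¬ Conflict (M i) (M j)

open Classical in
/-- `LHR(M)`: the maximum of `length(merge A) + length(merge B)` over disjoint,
pairwise non-conflicting sets `A, B` of rows of `M` (rows `1,…,n`). -/
noncomputable def LHR {m : ℕ} (M : ℤ → SnpRow m) (n : ℕ) : ℕ :=
  (((Finset.Icc (1 : ℤ) n).powerset ×ˢ (Finset.Icc (1 : ℤ) n).powerset).filter fun q =>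
      Disjoint q.1 q.2 ∧ PairwiseOK M q.1 ∧ PairwiseOK M q.2).sup fun q =>
    hlen (mergeRow M q.1) + hlen (mergeRow M q.2)

open Classical in
/-- `D[h,k;i]`: the maximum of `length(merge A) + length(merge B)` over disjoint,
pairwise non-conflicting sets `A, B` of rows from `{-1,0,1,…,i}` such that `k ∈ A`
maximizes `r(⬝)` in `A` and `h ∈ B` maximizes `r(⬝)` in `B`. -/
noncomputable def Dval {m : ℕ} (M : ℤ → SnpRow m) (h k i : ℤ) : ℕ :=
  (((Finset.Icc (-1 : ℤ) i).powerset ×ˢ (Finset.Icc (-1 : ℤ) i).powerset).filter fun q =>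
      Disjoint q.1 q.2 ∧ PairwiseOK M q.1 ∧ PairwiseOK M q.2 ∧
      k ∈ q.1 ∧ (∀ a ∈ q.1, rcol (M a) ≤ rcol (M k)) ∧
      h ∈ q.2 ∧ (∀ b ∈ q.2, rcol (M b) ≤ rcol (M h))).sup fun q =>
    hlen (mergeRow M q.1) + hlen (mergeRow M q.2)

open Classical in
/-- `OK(i)`: the rows `j ∈ {-1,0,…,i-1}` that do not conflict with row `i`. -/
noncomputable def OKset {m : ℕ} (M : ℤ → SnpRow m) (i : ℤ) : Finset ℤ :=
  (Finset.Icc (-1 : ℤ) (i - 1)).filter fun j => ¬ Conflict (M j) (M i)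

theorem merge_congr_aux {m : ℕ} (M : ℤ → SnpRow m) (R S : Finset ℤ)
    (h : ∀ i p, M i p ≠ none → (i ∈ R ↔ i ∈ S)) : mergeRow M R = mergeRow M S := by
  have key : ∀ p b, (∃ i ∈ R, M i p = some b) ↔ (∃ i ∈ S, M i p = some b) := by
    intro p b
    constructor
    · rintro ⟨i, hi, e⟩
      exact ⟨i, (h i p (by simp [e])).1 hi, e⟩
    · rintro ⟨i, hi, e⟩
      exact ⟨i, (h i p (by simp [e])).2 hi, e⟩
  funext p
  simp only [mergeRow, key]

theorem ok_insert_aux {m : ℕ} (M : ℤ → SnpRow m) (R : Finset ℤ) (z : ℤ)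
    (hz : M z = fun _ => none) (h : PairwiseOK M R) : PairwiseOK M (insert z R) := by
  intro i hi j hj
  rw [Finset.mem_insert] at hi hj
  rcases hi with rfl | hi
  · rintro ⟨p, b1, b2, e1, -⟩
    simp [hz] at e1
  · rcases hj with rfl | hj
    · rintro ⟨p, b1, b2, -, e1, -⟩
      simp [hz] at e1
    · exact h i hi j hj

theorem merge_insert_aux {m : ℕ} (M : ℤ → SnpRow m) (R : Finset ℤ) (z : ℤ)
    (hz : M z = fun _ => none) : mergeRow M (insert z R) = mergeRow M R := by
  apply merge_congr_aux
  intro i p hi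
  have : i ≠ z := by
    rintro rfl
    simp [hz] at hi
  simp [this]

theorem dval_ge_aux {m : ℕ} (M : ℤ → SnpRow m) (n : ℤ) (A B : Finset ℤ)
    (hA : A ⊆ Finset.Icc (-1) n) (hB : B ⊆ Finset.Icc (-1) n) (hd : Disjoint A B)
    (oA : PairwiseOK M A) (oB : PairwiseOK M B) (h k : ℤ)
    (hk : k ∈ A) (hk' : ∀ a ∈ A, rcol (M a) ≤ rcol (M k))
    (hh : h ∈ B) (hh' : ∀ a ∈ B, rcol (M a) ≤ rcol (M h)) :
    hlen (mergeRow M A) + hlen (mergeRow M B) ≤ Dval M h k n := by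
  classical
  unfold Dval
  refine Finset.le_sup (f := fun q : Finset ℤ × Finset ℤ =>
    hlen (mergeRow M q.1) + hlen (mergeRow M q.2)) (b := (A, B)) ?_
  simp only [Finset.mem_filter, Finset.mem_product, Finset.mem_powerset]
  exact ⟨⟨hA, hB⟩, hd, oA, oB, hk, hk', hh, hh'⟩

theorem stmt6 (n m : ℕ) (M : ℤ → SnpRow m)
    (hug : ∀ i : ℤ, 1 ≤ i → i ≤ n → Ungapped (M i))
    (h0 : M 0 = fun _ => none) (hm1 : M (-1) = fun _ => none)
    (hord : ∀ i j : ℤ, 1 ≤ i → i < j → j ≤ n → lcol (M i) ≤ lcol (M j)) :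
    LHR M n =
      (((Finset.Icc (-1 : ℤ) n) ×ˢ (Finset.Icc (-1 : ℤ) n)).filter fun q =>
          q.1 ≠ q.2 ∧ rcol (M q.1) ≤ rcol (M q.2)).sup fun q =>
        Dval M q.1 q.2 n := by
  classical
  apply le_antisymm
  · unfold LHR
    apply Finset.sup_le
    rintro ⟨A, B⟩ hq
    simp only [Finset.mem_filter, Finset.mem_product, Finset.mem_powerset] at hq
    obtain ⟨⟨hA, hB⟩, hd, oA, oB⟩ := hq
    have hA' : insert 0 A ⊆ Finset.Icc (-1 : ℤ) n := by
      intro x hx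
      rw [Finset.mem_insert] at hx
      rw [Finset.mem_Icc]
      rcases hx with rfl | hx
      · omega
      · have := Finset.mem_Icc.1 (hA hx)
        omega
    have hB' : insert (-1) B ⊆ Finset.Icc (-1 : ℤ) n := by
      intro x hx
      rw [Finset.mem_insert] at hx
      rw [Finset.mem_Icc]
      rcases hx with rfl | hx
      · omega
      · have := Finset.mem_Icc.1 (hB hx)
        omega
    have hd' : Disjoint (insert 0 A) (insert (-1) B) := by
      rw [Finset.disjoint_left] at hd ⊢
      intro x hx hy
      rw [Finset.mem_insert] at hx hy
      rcases hx with rfl | hx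
      · rcases hy with hy | hy
        · omega
        · have := Finset.mem_Icc.1 (hB hy)
          omega
      · rcases hy with rfl | hy
        · have := Finset.mem_Icc.1 (hA hx)
          omega
        · exact hd hx hy
    have oA' := ok_insert_aux M A 0 h0 oA
    have oB' := ok_insert_aux M B (-1) hm1 oB
    obtain ⟨k, hk, hk'⟩ := Finset.exists_max_image (insert 0 A) (fun a => rcol (M a))
      ⟨0, Finset.mem_insert_self _ _⟩
    obtain ⟨h, hh, hh'⟩ := Finset.exists_max_image (insert (-1) B) (fun a => rcol (M a))
      ⟨-1, Finset.mem_insert_self _ _⟩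
    have hne : h ≠ k := by
      rintro rfl
      exact Finset.disjoint_left.1 hd' hk hh
    dsimp only
    rw [← merge_insert_aux M A 0 h0, ← merge_insert_aux M B (-1) hm1]
    rcases le_total (rcol (M h)) (rcol (M k)) with hle | hle
    · refine (dval_ge_aux M n _ _ hA' hB' hd' oA' oB' h k hk hk' hh hh').trans ?_
      refine Finset.le_sup (f := fun q : ℤ × ℤ => Dval M q.1 q.2 n) (b := (h, k)) ?_
      simp only [Finset.mem_filter, Finset.mem_product]
      exact ⟨⟨hB' hh, hA' hk⟩, hne, hle⟩
    · rw [add_comm]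
      refine (dval_ge_aux M n _ _ hB' hA' hd'.symm oB' oA' k h hh hh' hk hk').trans ?_
      refine Finset.le_sup (f := fun q : ℤ × ℤ => Dval M q.1 q.2 n) (b := (k, h)) ?_
      simp only [Finset.mem_filter, Finset.mem_product]
      exact ⟨⟨hA' hk, hB' hh⟩, hne.symm, hle⟩
  · apply Finset.sup_le
    rintro ⟨h, k⟩ -
    unfold Dval
    apply Finset.sup_le
    rintro ⟨A, B⟩ hq
    simp only [Finset.mem_filter, Finset.mem_product, Finset.mem_powerset] at hq
    obtain ⟨⟨hA, hB⟩, hd, oA, oB, -⟩ := hq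
    have key : ∀ R : Finset ℤ, R ⊆ Finset.Icc (-1 : ℤ) n →
        mergeRow M R = mergeRow M (R ∩ Finset.Icc (1 : ℤ) n) := by
      intro R hR
      apply merge_congr_aux
      intro i p hi
      have e0 : i ≠ 0 := by
        rintro rfl
        simp [h0] at hi
      have e1 : i ≠ -1 := by
        rintro rfl
        simp [hm1] at hi
      rw [Finset.mem_inter, Finset.mem_Icc]
      constructor
      · intro hx
        have := Finset.mem_Icc.1 (hR hx)
        exact ⟨hx, by omega, by omega⟩
      · exact fun hx => hx.1
    dsimp only
    rw [key A hA, key B hB]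
    unfold LHR
    refine Finset.le_sup (f := fun q : Finset ℤ × Finset ℤ =>
      hlen (mergeRow M q.1) + hlen (mergeRow M q.2))
      (b := (A ∩ Finset.Icc (1 : ℤ) n, B ∩ Finset.Icc (1 : ℤ) n)) ?_
    simp only [Finset.mem_filter, Finset.mem_product, Finset.mem_powerset]
    refine ⟨⟨Finset.inter_subset_right, Finset.inter_subset_right⟩,
      hd.mono Finset.inter_subset_left Finset.inter_subset_left, ?_, ?_⟩
    · exact fun i hi j hj => oA i (Finset.mem_inter.1 hi).1 j (Finset.mem_inter.1 hj).1
    · exact fun i hi j hj => oB i (Finset.mem_inter.1 hi).1 j (Finset.mem_inter.1 hj).1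
end

section
/- Let M be an n×m ungapped SNP matrix whose rows 1,...,n are ordered so that l(i) ≤ l(j) whenever i < j, augmented by two all-hole rows with indices 0 and −1. Then for all indices 1 ≤ i ≤ n and all distinct h,k ∈ {−1,0,...,i−1} with r(h) ≤ r(k), it holds that D[h,k;i] = D[h,k;i−1]. -/
theorem le_rcol_aux {m : ℕ} (r : SnpRow m) (p : Fin m) (hp : r p ≠ none) :
    p.val + 1 ≤ rcol r := by
  unfold rcol
  exact Finset.le_sup (f := fun p : Fin m => p.val + 1) (by simpa using hp)

theorem lcol_le_aux {m : ℕ} (r : SnpRow m) (p : Fin m) (hp : r p ≠ none) :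
    lcol r ≤ p.val + 1 := Nat.sInf_le ⟨p, hp, rfl⟩

theorem rcol_mem_aux {m : ℕ} (r : SnpRow m) (h : 0 < rcol r) :
    ∃ p : Fin m, r p ≠ none ∧ p.val + 1 = rcol r := by
  unfold rcol at h ⊢
  have hne : (Finset.univ.filter fun p : Fin m => r p ≠ none).Nonempty := by
    rw [Finset.nonempty_iff_ne_empty]
    intro he
    rw [he] at h
    simp at h
  obtain ⟨p, hp, he⟩ := Finset.exists_mem_eq_sup _ hne (fun p : Fin m => p.val + 1)
  exact ⟨p, by simpa using hp, he.symm⟩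

theorem rcol_none_aux {m : ℕ} : rcol (fun _ : Fin m => (none : Option Bool)) = 0 := by
  simp [rcol]

theorem cover_aux {m : ℕ} (r s : SnpRow m) (hr : Ungapped r) (hl : lcol r ≤ lcol s)
    (hrc : rcol s ≤ rcol r) (p : Fin m) (hp : s p ≠ none) : r p ≠ none := by
  have h1 := le_rcol_aux s p hp
  have h2 := lcol_le_aux s p hp
  obtain ⟨b, hb, hb2⟩ := rcol_mem_aux r (by omega)
  obtain ⟨a, ha, ha2⟩ := Nat.sInf_mem (s := {c | ∃ p : Fin m, r p ≠ none ∧ p.val + 1 = c})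
    ⟨_, b, hb, rfl⟩
  change a.val + 1 = lcol r at ha2
  exact hr a p b (Fin.le_def.2 (by omega)) (Fin.le_def.2 (by omega)) ha hb

theorem mergeRow_ne_aux {m : ℕ} (M : ℤ → SnpRow m) (R : Finset ℤ) (p : Fin m) :
    mergeRow M R p ≠ none ↔ ∃ i ∈ R, M i p ≠ none := by
  unfold mergeRow
  constructor
  · intro h
    split_ifs at h with h1 h2
    · obtain ⟨i, hi, h⟩ := h1
      exact ⟨i, hi, by simp [h]⟩
    · obtain ⟨i, hi, h⟩ := h2
      exact ⟨i, hi, by simp [h]⟩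
    · exact absurd rfl h
  · rintro ⟨i, hi, h⟩
    split_ifs with h1 h2
    · simp
    · simp
    · exfalso
      rcases hb : M i p with _ | b
      · exact h hb
      · cases b
        · exact h2 ⟨i, hi, hb⟩
        · exact h1 ⟨i, hi, hb⟩

theorem hlen_erase_aux {m : ℕ} (M : ℤ → SnpRow m) (R : Finset ℤ) (i k : ℤ) (hk : k ∈ R)
    (hki : k ≠ i) (hc : i ∈ R → ∀ p, M i p ≠ none → M k p ≠ none) :
    hlen (mergeRow M R) ≤ hlen (mergeRow M (R.erase i)) := by
  unfold hlen
  apply Finset.card_le_card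
  intro p
  simp only [Finset.mem_filter, Finset.mem_univ, true_and, mergeRow_ne_aux]
  rintro ⟨j, hj, h⟩
  by_cases hji : j = i
  · subst hji
    exact ⟨k, Finset.mem_erase.2 ⟨hki, hk⟩, hc hj p h⟩
  · exact ⟨j, Finset.mem_erase.2 ⟨hji, hj⟩, h⟩

theorem stmt7 (n m : ℕ) (M : ℤ → SnpRow m)
    (hug : ∀ i : ℤ, 1 ≤ i → i ≤ n → Ungapped (M i))
    (h0 : M 0 = fun _ => none) (hm1 : M (-1) = fun _ => none)
    (hord : ∀ i j : ℤ, 1 ≤ i → i < j → j ≤ n → lcol (M i) ≤ lcol (M j)) :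
    ∀ i : ℤ, 1 ≤ i → i ≤ n →
      ∀ h k : ℤ, h ∈ Finset.Icc (-1 : ℤ) (i - 1) → k ∈ Finset.Icc (-1 : ℤ) (i - 1) →
        h ≠ k → rcol (M h) ≤ rcol (M k) →
          Dval M h k i = Dval M h k (i - 1) := by
  intro i hi hin h k hh hk hne hr
  rw [Finset.mem_Icc] at hh hk
  have key : ∀ k : ℤ, -1 ≤ k → k ≤ i - 1 → rcol (M i) ≤ rcol (M k) →
      ∀ p, M i p ≠ none → M k p ≠ none := by
    intro k hk1 hk2 hrc p hp
    by_cases hk0 : 1 ≤ k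
    · exact cover_aux _ _ (hug k hk0 (by omega)) (hord k i hk0 (by omega) hin) hrc p hp
    · exfalso
      have h1 := le_rcol_aux _ p hp
      have h2 : rcol (M k) = 0 := by
        have : k = 0 ∨ k = -1 := by omega
        rcases this with rfl | rfl
        · rw [h0, rcol_none_aux]
        · rw [hm1, rcol_none_aux]
      omega
  have hsub : ∀ A ⊆ Finset.Icc (-1 : ℤ) i, A.erase i ⊆ Finset.Icc (-1 : ℤ) (i - 1) := by
    intro A hA x hx
    obtain ⟨hx1, hx2⟩ := Finset.mem_erase.1 hx
    have := Finset.mem_Icc.1 (hA hx2)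
    rw [Finset.mem_Icc]
    omega
  have hOK : ∀ A : Finset ℤ, PairwiseOK M A → PairwiseOK M (A.erase i) := fun A hA a ha b hb =>
    hA a (Finset.mem_of_mem_erase ha) b (Finset.mem_of_mem_erase hb)
  apply le_antisymm
  · unfold Dval
    apply Finset.sup_le
    rintro ⟨A, B⟩ hq
    simp only [Finset.mem_filter, Finset.mem_product, Finset.mem_powerset] at hq
    obtain ⟨⟨hA, hB⟩, hd, hAo, hBo, hkA, hkm, hhB, hhm⟩ := hq
    refine le_trans (add_le_add
      (hlen_erase_aux M A i k hkA (by omega) fun hiA => key k hk.1 hk.2 (hkm i hiA))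
      (hlen_erase_aux M B i h hhB (by omega) fun hiB => key h hh.1 hh.2 (hhm i hiB))) ?_
    refine Finset.le_sup (f := fun q : Finset ℤ × Finset ℤ =>
      hlen (mergeRow M q.1) + hlen (mergeRow M q.2)) (b := (A.erase i, B.erase i)) ?_
    simp only [Finset.mem_filter, Finset.mem_product, Finset.mem_powerset]
    exact ⟨⟨hsub A hA, hsub B hB⟩,
      Finset.disjoint_of_subset_left (Finset.erase_subset _ _)
        (Finset.disjoint_of_subset_right (Finset.erase_subset _ _) hd),
      hOK A hAo, hOK B hBo, Finset.mem_erase.2 ⟨by omega, hkA⟩,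
      fun a ha => hkm a (Finset.mem_of_mem_erase ha), Finset.mem_erase.2 ⟨by omega, hhB⟩,
      fun a ha => hhm a (Finset.mem_of_mem_erase ha)⟩
  · unfold Dval
    apply Finset.sup_mono
    have hI : Finset.Icc (-1 : ℤ) (i - 1) ⊆ Finset.Icc (-1 : ℤ) i :=
      Finset.Icc_subset_Icc le_rfl (by omega)
    rintro ⟨A, B⟩ hq
    simp only [Finset.mem_filter, Finset.mem_product, Finset.mem_powerset] at hq ⊢
    exact ⟨⟨hq.1.1.trans hI, hq.1.2.trans hI⟩, hq.2⟩
end
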